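/- arXiv:2203.07636 — 6 statements merged into one kernel-verified Lean document; each statement's English description precedes it below -/
import Mathlib

section
/- For every positive even integer r, the double sum \(\sum_{p=0}^{r/2} \sum_{q=0}^{r/2-p} \frac{\binom{r}{2p}\binom{r-2p}{2q}}{(2p+1)(2q+1)(r-2p-2q+1)}\) equals \(\frac{3^{r+3}-3}{4(r+1)(r+2)(r+3)}\). Consequently, for every real number a, \(\frac{a^r}{3^r}\sum_{p=0}^{r/2}\sum_{q=0}^{r/2-p}\frac{\binom{r}{2p}\binom{r-2p}{2q}}{(2p+1)(2q+1)(r-2p-2q+1)} = \frac{a^r}{3^r}\cdot\frac{3^{r+3}-3}{4(r+1)(r+2)(r+3)}\). (Lemma 3(1) of the paper: closed form of the coefficient f_r appearing in the recursion for even-order central moments of the GWO iterate.) -/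
open Finset

/-- Weighting by `1 - (-1) ^ j` selects twice the odd-indexed terms. -/
lemma sum_range_one_sub_neg_one_pow_mul (h : ℕ → ℝ) (n : ℕ) :
    ∑ j ∈ Finset.range (2 * n + 1), (1 - (-1) ^ j) * h j =
      2 * ∑ p ∈ Finset.range n, h (2 * p + 1) := by
  induction n with
  | zero => simp
  | succ n ih =>
    rw [show 2 * (n + 1) + 1 = 2 * n + 1 + 1 + 1 by ring, Finset.sum_range_succ,
      Finset.sum_range_succ, ih, Finset.sum_range_succ]
    simp only [pow_succ, pow_mul]
    norm_num
    ring

/-- The odd part of the binomial expansion. -/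
lemma two_mul_sum_odd_choose_mul_pow (x : ℝ) {N n : ℕ} (hN : N ≤ 2 * n) :
    2 * ∑ p ∈ Finset.range n, (N.choose (2 * p + 1) : ℝ) * x ^ (N - (2 * p + 1)) =
      (x + 1) ^ N - (x - 1) ^ N := by
  rw [← sum_range_one_sub_neg_one_pow_mul (fun j => (N.choose j : ℝ) * x ^ (N - j)),
    add_comm x 1, sub_eq_neg_add x 1, add_pow, add_pow, ← Finset.sum_sub_distrib]
  symm
  apply Finset.sum_subset_zero_on_sdiff
  · exact Finset.range_subset_range.2 (by omega)
  · intro j hj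
    simp only [Finset.mem_sdiff, Finset.mem_range] at hj
    simp [Nat.choose_eq_zero_of_lt (show N < j by omega)]
  · intro j _
    ring

/-- Absorbing one factor on each side of a binomial coefficient. -/
lemma choose_div_succ_mul_succ (a b : ℕ) :
    ((a + b).choose a : ℝ) / ((a + 1) * (b + 1)) =
      ((a + b + 2).choose (a + 1) : ℝ) / ((a + b + 1) * (a + b + 2)) := by
  rw [show a + b + 2 = (a + 1) + (b + 1) by ring, Nat.cast_add_choose, Nat.cast_add_choose,
    show (a + 1) + (b + 1) = a + b + 1 + 1 by ring]
  simp only [Nat.factorial_succ]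
  have ha : (a.factorial : ℝ) ≠ 0 := by positivity
  have hb : (b.factorial : ℝ) ≠ 0 := by positivity
  push_cast
  field_simp
  ring

/-- Absorbing one factor on the left and two on the right of a binomial coefficient. -/
lemma choose_div_succ_mul_succ_mul_succ_succ (a b : ℕ) :
    ((a + b).choose a : ℝ) / ((a + 1) * ((b + 1) * (b + 2))) =
      ((a + b + 3).choose (a + 1) : ℝ) / ((a + b + 1) * (a + b + 2) * (a + b + 3)) := by
  rw [show a + b + 3 = (a + 1) + (b + 2) by ring, Nat.cast_add_choose, Nat.cast_add_choose,
    show (a + 1) + (b + 2) = a + b + 1 + 1 + 1 by ring]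
  simp only [Nat.factorial_succ]
  have ha : (a.factorial : ℝ) ≠ 0 := by positivity
  have hb : (b.factorial : ℝ) ≠ 0 := by positivity
  push_cast
  field_simp
  ring

lemma sum_choose_even_div (k : ℕ) :
    ∑ q ∈ Finset.range (k + 1),
        ((2 * k).choose (2 * q) : ℝ) / ((2 * q + 1) * ((2 * k - 2 * q : ℕ) + 1)) =
      2 ^ (2 * k + 1) / ((2 * k + 1) * (2 * k + 2)) := by
  have key := two_mul_sum_odd_choose_mul_pow 1 (N := 2 * k + 2) (n := k + 1) (by omega)
  have hsum : ∑ q ∈ Finset.range (k + 1), ((2 * k + 2).choose (2 * q + 1) : ℝ) =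
      2 ^ (2 * k + 1) := by
    norm_num [pow_succ] at key ⊢
    linarith
  rw [← hsum, Finset.sum_div]
  refine Finset.sum_congr rfl fun q hq => ?_
  obtain ⟨j, rfl⟩ : ∃ j, k = q + j := Nat.exists_eq_add_of_le (by
    have := Finset.mem_range.1 hq
    omega)
  have h := choose_div_succ_mul_succ (2 * q) (2 * j)
  rw [show 2 * (q + j) - 2 * q = 2 * j by omega, show 2 * (q + j) = 2 * q + 2 * j by ring]
  push_cast at h ⊢
  rw [h]
  ring

lemma sum_choose_even_mul_two_pow_div (m : ℕ) :
    ∑ p ∈ Finset.range (m + 1), ((2 * m).choose (2 * p) : ℝ) / (2 * p + 1) *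
        (2 ^ (2 * (m - p) + 1) / ((2 * (m - p : ℕ) + 1) * (2 * (m - p : ℕ) + 2))) =
      ((3 : ℝ) ^ (2 * m + 3) - 3) /
        (4 * ((2 * m : ℝ) + 1) * ((2 * m : ℝ) + 2) * ((2 * m : ℝ) + 3)) := by
  have key := two_mul_sum_odd_choose_mul_pow 2 (N := 2 * m + 3) (n := m + 2) (by omega)
  have hsum : ∑ p ∈ Finset.range (m + 1),
      ((2 * m + 3).choose (2 * p + 1) : ℝ) * 2 ^ (2 * m + 3 - (2 * p + 1)) =
      (3 ^ (2 * m + 3) - 3) / 2 := by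
    rw [Finset.sum_range_succ, show 2 * (m + 1) + 1 = 2 * m + 3 by ring] at key
    norm_num at key ⊢
    linarith
  have hrhs : ((3 : ℝ) ^ (2 * m + 3) - 3) /
        (4 * ((2 * m : ℝ) + 1) * ((2 * m : ℝ) + 2) * ((2 * m : ℝ) + 3)) =
      (3 ^ (2 * m + 3) - 3) / 2 /
        (2 * (((2 * m : ℝ) + 1) * ((2 * m : ℝ) + 2) * ((2 * m : ℝ) + 3))) := by
    field_simp
    ring
  rw [hrhs, ← hsum, Finset.sum_div]
  refine Finset.sum_congr rfl fun p hp => ?_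
  obtain ⟨j, rfl⟩ : ∃ j, m = p + j := Nat.exists_eq_add_of_le (by
    have := Finset.mem_range.1 hp
    omega)
  have h := choose_div_succ_mul_succ_mul_succ_succ (2 * p) (2 * j)
  rw [show p + j - p = j by omega, show 2 * (p + j) + 3 - (2 * p + 1) = 2 * j + 1 + 1 by omega,
    show 2 * (p + j) = 2 * p + 2 * j by ring, pow_succ _ (2 * j + 1)]
  push_cast at h ⊢
  calc _ = 2 ^ (2 * j + 1) * (((2 * p + 2 * j).choose (2 * p) : ℝ) /
        ((2 * p + 1) * ((2 * j + 1) * (2 * j + 2)))) := by field_simp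
    _ = _ := by
      rw [h]
      field_simp

/-- Lemma 3(1): closed form of the coefficient `f_r` in the recursion for the
even-order central moments of the GWO iterate. -/
theorem gwo_fr_closed_form (r : ℕ) (hr : 0 < r) (hreven : Even r) :
    (∑ p ∈ Finset.range (r / 2 + 1), ∑ q ∈ Finset.range (r / 2 - p + 1),
        ((r.choose (2 * p) : ℝ) * ((r - 2 * p).choose (2 * q) : ℝ)) /
          ((2 * p + 1) * (2 * q + 1) * ((r - 2 * p - 2 * q : ℕ) + 1)))
      = ((3 : ℝ) ^ (r + 3) - 3) / (4 * (r + 1) * (r + 2) * (r + 3)) ∧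
    ∀ a : ℝ,
      a ^ r / 3 ^ r *
          (∑ p ∈ Finset.range (r / 2 + 1), ∑ q ∈ Finset.range (r / 2 - p + 1),
            ((r.choose (2 * p) : ℝ) * ((r - 2 * p).choose (2 * q) : ℝ)) /
              ((2 * p + 1) * (2 * q + 1) * ((r - 2 * p - 2 * q : ℕ) + 1)))
        = a ^ r / 3 ^ r *
            (((3 : ℝ) ^ (r + 3) - 3) / (4 * (r + 1) * (r + 2) * (r + 3))) := by
  suffices h : _ from ⟨h, fun a => congrArg _ h⟩
  obtain ⟨m, rfl⟩ := hreven.two_dvd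
  rw [Nat.mul_div_cancel_left m two_pos]
  have hm := sum_choose_even_mul_two_pow_div m
  push_cast
  rw [← hm]
  refine Finset.sum_congr rfl fun p _ => ?_
  rw [← sum_choose_even_div (m - p), Finset.mul_sum]
  refine Finset.sum_congr rfl fun q _ => ?_
  rw [Nat.mul_sub 2 m p, div_mul_div_comm, mul_assoc (2 * (p : ℝ) + 1)]
end

section
/- For every natural number m, \(\sum_{q=0}^{m} \frac{\binom{2m}{2q}}{(2q+1)(2m-2q+1)} = \frac{2^{2m+1}}{(2m+1)(2m+2)}\). -/
open Finset

theorem sum_range_choose_odd (m : ℕ) :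
    ∑ q ∈ range (m + 1), (2 * m + 2).choose (2 * q + 1) = 2 ^ (2 * m + 1) := by
  have pair_sum (f : ℕ → ℕ) (k : ℕ) :
      ∑ q ∈ range k, (f (2 * q) + f (2 * q + 1)) = ∑ i ∈ range (2 * k), f i := by
    induction k with
    | zero => simp
    | succ k ih => rw [sum_range_succ, ih, Nat.mul_succ, sum_range_succ, sum_range_succ, add_assoc]
  rw [← Nat.sum_range_choose (2 * m + 1), show 2 * m + 1 + 1 = 2 * (m + 1) by ring, ← pair_sum]
  exact sum_congr rfl fun q _ => Nat.choose_succ_succ _ _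

theorem choose_div_mul_eq (n k : ℕ) (hk : k ≤ n) :
    (n.choose k : ℚ) / ((k + 1) * ((n - k : ℕ) + 1)) =
      (n + 2).choose (k + 1) / ((n + 1) * (n + 2)) := by
  obtain ⟨l, rfl⟩ := Nat.exists_eq_add_of_le hk
  have h₁ := Nat.add_one_mul_choose_eq (k + l) k
  have h₂ := Nat.choose_mul_succ_eq (k + l + 1) (k + 1)
  rw [show k + l + 1 + 1 - (k + 1) = l + 1 by omega] at h₂
  qify at h₁ h₂
  rw [Nat.add_sub_cancel_left, div_eq_div_iff (by positivity) (by positivity)]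
  push_cast
  linear_combination ((k : ℚ) + l + 2) * h₁ + ((k : ℚ) + 1) * h₂

/-- Inner-sum identity used in the proof of Lemma 3(1):
`∑_{q=0}^{m} C(2m, 2q) / ((2q+1)(2m-2q+1)) = 2^(2m+1) / ((2m+1)(2m+2))`. -/
theorem gwo_inner_sum (m : ℕ) :
    (∑ q ∈ Finset.range (m + 1),
        (((2 * m).choose (2 * q) : ℚ)) /
          ((2 * q + 1) * ((2 * m - 2 * q : ℕ) + 1)))
      = (2 : ℚ) ^ (2 * m + 1) / ((2 * m + 1) * (2 * m + 2)) := by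
  have h := congrArg (Nat.cast (R := ℚ)) (sum_range_choose_odd m)
  push_cast at h
  rw [← h, sum_div]
  refine sum_congr rfl fun q hq => ?_
  have hle : 2 * q ≤ 2 * m := by
    have := mem_range.mp hq
    omega
  simpa only [Nat.cast_mul, Nat.cast_ofNat] using choose_div_mul_eq (2 * m) (2 * q) hle
end

section
/- Define, for real r \(\ge\) 2, \(a_r = 3\left(\frac{4(r+1)(r+2)(r+3)}{3^{r+3}-3}\right)^{1/r}\). Then the function \(r \mapsto a_r\) is strictly decreasing on \([2, \infty)\). In particular, for positive even integers r < s one has \(a_s < a_r\). (Lemma 3(2) of the paper.) -/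
open Real

/-- The logarithm of `4 (r + 1) (r + 2) (r + 3) / 27`. -/
noncomputable def gwoLogNumerator (r : ℝ) : ℝ :=
  log (4 / 27) + (log (r + 1) + log (r + 2) + log (r + 3))

lemma log_add_le_log_add_of_pos {x y : ℝ} (hx : 0 < x) (hy : 0 < y) :
    log y ≤ log x + (y - x) / x := by
  have h := log_le_sub_one_of_pos (div_pos hy hx)
  rw [log_div hy.ne' hx.ne'] at h
  have e : (y - x) / x = y / x - 1 := by field_simp
  linarith

lemma div_add_add_log_le {r i : ℝ} (hr : 2 ≤ r) (hi : 0 ≤ i) :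
    r / (r + i) + log (2 + i) ≤ log (r + i) + 2 / (2 + i) := by
  have hri : 0 < r + i := by linarith
  have h := log_add_le_log_add_of_pos hri (show 0 < 2 + i by linarith)
  have e : (2 + i - (r + i)) / (r + i) = 2 / (r + i) - r / (r + i) := by
    field_simp
    ring
  have h2 : 2 / (r + i) ≤ 2 / (2 + i) := by gcongr
  linarith

lemma sum_div_add_lt_gwoLogNumerator {r : ℝ} (hr : 2 ≤ r) :
    r / (r + 1) + r / (r + 2) + r / (r + 3) < gwoLogNumerator r := by
  have h1 := div_add_add_log_le hr (i := 1) (by norm_num)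
  have h2 := div_add_add_log_le hr (i := 2) (by norm_num)
  have h3 := div_add_add_log_le hr (i := 3) (by norm_num)
  have h8 : 3 * log 2 ≤ log (4 / 27) + log (2 + 1) + log (2 + 2) + log (2 + 3) := by
    rw [← log_mul (by norm_num) (by norm_num), ← log_mul (by norm_num) (by norm_num),
      ← log_mul (by norm_num) (by norm_num), ← log_rpow (by norm_num)]
    exact log_le_log (by positivity) (by norm_num)
  have := log_two_gt_d9
  unfold gwoLogNumerator
  norm_num at h1 h2 h3 h8 ⊢
  linarith

lemma gwoLogNumerator_div_lt {r s : ℝ} (hr : 2 ≤ r) (hrs : r < s) :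
    gwoLogNumerator s / s < gwoLogNumerator r / r := by
  have tangent : ∀ i : ℝ, 0 < i → r * log (s + i) ≤ r * log (r + i) + (s - r) * (r / (r + i)) := by
    intro i hi
    have h := log_add_le_log_add_of_pos (show 0 < r + i by linarith) (show 0 < s + i by linarith)
    calc r * log (s + i) ≤ r * (log (r + i) + (s + i - (r + i)) / (r + i)) := by gcongr
      _ = _ := by ring
  have h1 := tangent 1 (by norm_num)
  have h2 := tangent 2 (by norm_num)
  have h3 := tangent 3 (by norm_num)
  have h := mul_lt_mul_of_pos_left (sum_div_add_lt_gwoLogNumerator hr) (sub_pos.2 hrs)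
  rw [div_lt_div_iff₀ (by linarith) (by linarith)]
  unfold gwoLogNumerator at *
  linarith

lemma one_sub_three_rpow_pos {r : ℝ} (hr : 2 ≤ r) : 0 < 1 - (3 : ℝ) ^ (-(r + 2)) := by
  have := rpow_lt_one_of_one_lt_of_neg (x := (3 : ℝ)) (z := -(r + 2)) (by norm_num) (by linarith)
  linarith

lemma neg_log_one_sub_three_rpow_div_le {r s : ℝ} (hr : 2 ≤ r) (hrs : r ≤ s) :
    -log (1 - (3 : ℝ) ^ (-(s + 2))) / s ≤ -log (1 - (3 : ℝ) ^ (-(r + 2))) / r := by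
  have hpow : (3 : ℝ) ^ (-(s + 2)) ≤ (3 : ℝ) ^ (-(r + 2)) :=
    rpow_le_rpow_of_exponent_le (by norm_num) (by linarith)
  have hlog := log_le_log (one_sub_three_rpow_pos hr)
    (show 1 - (3 : ℝ) ^ (-(r + 2)) ≤ 1 - (3 : ℝ) ^ (-(s + 2)) by linarith)
  have hneg : log (1 - (3 : ℝ) ^ (-(r + 2))) ≤ 0 :=
    log_nonpos (one_sub_three_rpow_pos hr).le
      (by linarith [rpow_pos_of_pos (show (0 : ℝ) < 3 by norm_num) (-(r + 2))])
  exact div_le_div₀ (by linarith) (by linarith) (by linarith) hrs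

lemma gwo_root_eq_exp {r : ℝ} (hr : 2 ≤ r) :
    ((4 * (r + 1) * (r + 2) * (r + 3)) / ((3 : ℝ) ^ (r + 3) - 3)) ^ (1 / r) =
      exp (-log 3 + (gwoLogNumerator r / r + -log (1 - (3 : ℝ) ^ (-(r + 2))) / r)) := by
  have hq := one_sub_three_rpow_pos hr
  have h3 : (0 : ℝ) < 3 ^ r := by positivity
  have hden : (3 : ℝ) ^ (r + 3) - 3 = 27 * 3 ^ r * (1 - 3 ^ (-(r + 2))) := by
    rw [rpow_neg (by norm_num), rpow_add (by norm_num), rpow_add (by norm_num)]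
    norm_num
    field_simp
    ring
  have hfrac : (4 * (r + 1) * (r + 2) * (r + 3)) / ((3 : ℝ) ^ (r + 3) - 3) =
      4 / 27 * ((r + 1) * (r + 2) * (r + 3)) / (3 ^ r * (1 - 3 ^ (-(r + 2)))) := by
    rw [hden]
    field_simp
  have hr1 : 0 < r + 1 := by linarith
  have hr2 : 0 < r + 2 := by linarith
  have hr3 : 0 < r + 3 := by linarith
  rw [hfrac, rpow_def_of_pos (by positivity), log_div (by positivity) (by positivity),
    log_mul (by norm_num) (by positivity), log_mul (by positivity) hr3.ne',
    log_mul hr1.ne' hr2.ne', log_mul h3.ne' hq.ne', log_rpow (by norm_num), gwoLogNumerator]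
  congr 1
  have : r ≠ 0 := by linarith
  field_simp
  ring

/-- Lemma 3(2): the root `a_r = 3 (4(r+1)(r+2)(r+3)/(3^(r+3)-3))^(1/r)` is a
strictly decreasing function of `r` on `[2, ∞)`; in particular it decreases along
positive even integers. -/
theorem gwo_ar_strictAnti :
    StrictAntiOn
      (fun r : ℝ =>
        3 * ((4 * (r + 1) * (r + 2) * (r + 3)) / ((3 : ℝ) ^ (r + 3) - 3)) ^ (1 / r))
      (Set.Ici (2 : ℝ)) ∧
    ∀ r s : ℕ, Even r → Even s → 0 < r → r < s →
      3 * ((4 * ((s : ℝ) + 1) * (s + 2) * (s + 3)) / ((3 : ℝ) ^ ((s : ℝ) + 3) - 3)) ^ (1 / (s : ℝ))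
        < 3 * ((4 * ((r : ℝ) + 1) * (r + 2) * (r + 3)) / ((3 : ℝ) ^ ((r : ℝ) + 3) - 3)) ^ (1 / (r : ℝ)) := by
  have anti : StrictAntiOn
      (fun r : ℝ =>
        3 * ((4 * (r + 1) * (r + 2) * (r + 3)) / ((3 : ℝ) ^ (r + 3) - 3)) ^ (1 / r))
      (Set.Ici (2 : ℝ)) := by
    intro r hr s hs hrs
    simp only [Set.mem_Ici] at hr hs
    simp only [gwo_root_eq_exp hr, gwo_root_eq_exp hs]
    have := gwoLogNumerator_div_lt hr hrs
    have := neg_log_one_sub_three_rpow_div_le hr hrs.le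
    gcongr 3 * exp ?_
    linarith
  refine ⟨anti, fun r s hr _ hpos hrs => ?_⟩
  have hr2 : 2 ≤ r := by
    obtain ⟨k, rfl⟩ := hr
    omega
  exact anti (Set.mem_Ici.2 (by exact_mod_cast hr2))
    (Set.mem_Ici.2 (by exact_mod_cast hr2.trans hrs.le)) (by exact_mod_cast hrs)
end

section
/- The function \(g(u) = \frac{1}{u-2}\,\ln\!\left(\frac{3(3^u-1)}{4u(u-1)(u+1)}\right)\) is strictly increasing on the interval \([4, \infty)\). -/
open Real

theorem sq_mul_exp_lt_exp_sub_one_sq {x : ℝ} (hx : 0 < x) :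
    x ^ 2 * exp x < (exp x - 1) ^ 2 := by
  have hs : x / 2 < sinh (x / 2) := self_lt_sinh_iff.2 (by positivity)
  have hpos := exp_pos (x / 2)
  have hinv : exp (x / 2) * exp (-(x / 2)) = 1 := by rw [← exp_add]; simp
  have hsq : exp x = exp (x / 2) ^ 2 := by rw [← exp_nat_mul]; congr 1; push_cast; ring
  have hlt : x * exp (x / 2) < exp x - 1 := by
    rw [sinh_eq] at hs
    nlinarith
  calc x ^ 2 * exp x = (x * exp (x / 2)) ^ 2 := by rw [hsq]; ring
    _ < (exp x - 1) ^ 2 := by gcongr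

/-- The logarithm of `(exp (c * u) - 1) / ((u - 1) * u * (u + 1))`, split into summands. -/
noncomputable def logExpRatio (c u : ℝ) : ℝ :=
  log (exp (c * u) - 1) - log u - log (u - 1) - log (u + 1)

theorem hasDerivAt_logExpRatio {c u : ℝ} (hc : 0 < c) (hu : 1 < u) :
    HasDerivAt (logExpRatio c)
      (exp (c * u) * c / (exp (c * u) - 1) - 1 / u - 1 / (u - 1) - 1 / (u + 1)) u := by
  have hE : exp (c * u) - 1 ≠ 0 := (sub_pos.2 (one_lt_exp_iff.2 (by positivity))).ne'
  have hid := hasDerivAt_id' u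
  have hexp : HasDerivAt (fun v => exp (c * v) - 1) (exp (c * u) * c) u := by
    simpa using ((hid.const_mul c).exp.sub_const 1)
  exact (((hexp.log hE).sub (hid.log (by linarith))).sub
    ((hid.sub_const 1).log (by linarith))).sub ((hid.add_const 1).log (by linarith))

theorem strictMonoOn_deriv_logExpRatio {c : ℝ} (hc : 0 < c) :
    StrictMonoOn (deriv (logExpRatio c)) (Set.Ioi 1) := by
  suffices h : StrictMonoOn (fun u =>
      exp (c * u) * c / (exp (c * u) - 1) - 1 / u - 1 / (u - 1) - 1 / (u + 1)) (Set.Ioi 1) from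
    h.congr fun u hu => (hasDerivAt_logExpRatio hc hu).deriv.symm
  have key : ∀ u ∈ Set.Ioi (1 : ℝ), HasDerivAt (fun u =>
      exp (c * u) * c / (exp (c * u) - 1) - 1 / u - 1 / (u - 1) - 1 / (u + 1))
      (1 / u ^ 2 - c ^ 2 * exp (c * u) / (exp (c * u) - 1) ^ 2
        + 1 / (u - 1) ^ 2 + 1 / (u + 1) ^ 2) u := by
    intro u (hu : 1 < u)
    have hE : exp (c * u) - 1 ≠ 0 := (sub_pos.2 (one_lt_exp_iff.2 (by positivity))).ne'
    have hid := hasDerivAt_id' u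
    have hexp : HasDerivAt (fun v => exp (c * v)) (exp (c * u) * c) u := by
      simpa using (hid.const_mul c).exp
    have h0 : u ≠ 0 := by linarith
    have h1 : u - 1 ≠ 0 := by linarith
    have h2 : u + 1 ≠ 0 := by linarith
    have H := ((((hexp.mul_const c).div (hexp.sub_const 1) hE).sub
      ((hasDerivAt_const u (1 : ℝ)).div hid h0)).sub
      ((hasDerivAt_const u (1 : ℝ)).div (hid.sub_const 1) h1)).sub
      ((hasDerivAt_const u (1 : ℝ)).div (hid.add_const 1) h2)
    refine H.congr_deriv ?_
    field_simp
    ring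
  refine strictMonoOn_of_deriv_pos (convex_Ioi 1)
    (fun u hu => (key u hu).continuousAt.continuousWithinAt) fun u hu => ?_
  rw [interior_Ioi] at hu
  rw [(key u hu).deriv]
  have hu1 : 1 < u := hu
  have hE : 0 < exp (c * u) - 1 := sub_pos.2 (one_lt_exp_iff.2 (by positivity))
  have hlt : c ^ 2 * exp (c * u) / (exp (c * u) - 1) ^ 2 < 1 / u ^ 2 := by
    rw [div_lt_div_iff₀ (by positivity) (by positivity)]
    linarith [sq_mul_exp_lt_exp_sub_one_sq (show 0 < c * u by positivity)]
  have : 0 ≤ 1 / (u - 1) ^ 2 := by positivity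
  have : 0 ≤ 1 / (u + 1) ^ 2 := by positivity
  linarith

theorem strictConvexOn_logExpRatio {c : ℝ} (hc : 0 < c) :
    StrictConvexOn ℝ (Set.Ioi 1) (logExpRatio c) := by
  refine StrictMonoOn.strictConvexOn_of_deriv (convex_Ioi 1)
    (fun u hu => (hasDerivAt_logExpRatio hc hu).continuousAt.continuousWithinAt) ?_
  rw [interior_Ioi]
  exact strictMonoOn_deriv_logExpRatio hc

theorem log_ratio_eq_logExpRatio_sub {u : ℝ} (hu : 1 < u) :
    log ((3 * ((3 : ℝ) ^ u - 1)) / (4 * u * (u - 1) * (u + 1))) =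
      logExpRatio (log 3) u - logExpRatio (log 3) 2 := by
  have hE : (3 : ℝ) ^ u - 1 ≠ 0 := (sub_pos.2 (one_lt_rpow (by norm_num) (by linarith))).ne'
  have h0 : u ≠ 0 := by linarith
  have h1 : u - 1 ≠ 0 := by linarith
  have h2 : u + 1 ≠ 0 := by linarith
  have h8 : log ((3 : ℝ) ^ (2 : ℝ) - 1) = log 4 + log 2 := by
    rw [← log_mul (by norm_num) (by norm_num)]; norm_num
  rw [log_div (by positivity) (by positivity), log_mul (by norm_num) hE,
    log_mul (by positivity) h2, log_mul (by positivity) h1, log_mul (by norm_num) h0]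
  simp only [logExpRatio, ← rpow_def_of_pos (show (0 : ℝ) < 3 by norm_num), h8]
  norm_num
  ring

/-- The function `g(u) = (1/(u-2)) ln(3(3^u - 1)/(4u(u-1)(u+1)))` is strictly
increasing on `[4, ∞)` (core of the proof of Lemma 3(2)). -/
theorem gwo_g_strictMono :
    StrictMonoOn
      (fun u : ℝ =>
        (1 / (u - 2)) * Real.log ((3 * ((3 : ℝ) ^ u - 1)) / (4 * u * (u - 1) * (u + 1))))
      (Set.Ici (4 : ℝ)) := by
  intro x (hx : 4 ≤ x) y (hy : 4 ≤ y) hxy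
  have h := (strictConvexOn_logExpRatio (log_pos (by norm_num : (1 : ℝ) < 3))).secant_strict_mono
    (a := 2) (x := x) (y := y) (Set.mem_Ioi.2 (by norm_num)) (Set.mem_Ioi.2 (by linarith))
    (Set.mem_Ioi.2 (by linarith)) (by linarith) (by linarith) hxy
  simp only [log_ratio_eq_logExpRatio_sub (show 1 < x by linarith),
    log_ratio_eq_logExpRatio_sub (show 1 < y by linarith), one_div_mul_eq_div]
  exact h
end

section
/- For every real number u \(\ge\) 4, \((3^u - 1)^2 (3u^4 + 1) > 3^u (\ln 3)^2\, u^2 (u^2 - 1)^2\). -/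
open Real

/-- Bernoulli's inequality, squared: `(1 + u)^2 ≤ 3^u` for `u ≥ 2`. -/
lemma one_add_sq_le_three_rpow {u : ℝ} (hu : 2 ≤ u) : (1 + u) ^ 2 ≤ (3 : ℝ) ^ u := by
  have bernoulli : 1 + u ≤ (3 : ℝ) ^ (u / 2) := by
    have h := one_add_mul_self_le_rpow_one_add (s := (2 : ℝ)) (by norm_num)
      (p := u / 2) (by linarith)
    norm_num at h
    linarith
  calc (1 + u) ^ 2 ≤ ((3 : ℝ) ^ (u / 2)) ^ 2 := by gcongr
    _ = (3 : ℝ) ^ u := by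
      rw [← rpow_natCast, ← rpow_mul (by norm_num)]
      norm_num

/-- Key positivity estimate in the proof of Lemma 3(2):
for `u ≥ 4`, `(3^u - 1)^2 (3u^4 + 1) > 3^u (ln 3)^2 u^2 (u^2 - 1)^2`. -/
theorem gwo_hprime_numerator_pos (u : ℝ) (hu : 4 ≤ u) :
    ((3 : ℝ) ^ u - 1) ^ 2 * (3 * u ^ 4 + 1)
      > (3 : ℝ) ^ u * (Real.log 3) ^ 2 * u ^ 2 * (u ^ 2 - 1) ^ 2 := by
  have h_rpow := one_add_sq_le_three_rpow (show 2 ≤ u by linarith)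
  have h_log : Real.log 3 ^ 2 < 2 := by
    nlinarith [log_three_lt_d9, log_three_gt_d9]
  set a := (3 : ℝ) ^ u
  have ha : 0 < a := by positivity
  have h_sq : a * u ^ 2 ≤ (a - 1) ^ 2 := by nlinarith
  calc a * Real.log 3 ^ 2 * u ^ 2 * (u ^ 2 - 1) ^ 2
      = a * u ^ 2 * (Real.log 3 ^ 2 * (u ^ 2 - 1) ^ 2) := by ring
    _ ≤ a * u ^ 2 * (2 * (u ^ 2 - 1) ^ 2) := by gcongr
    _ < a * u ^ 2 * (3 * u ^ 4 + 1) := by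
      gcongr
      nlinarith [sq_nonneg (u ^ 2)]
    _ ≤ (a - 1) ^ 2 * (3 * u ^ 4 + 1) := by gcongr
end

section
/- For every even integer r \(\ge\) 8 and every real number a with 1.9 \(\le\) a \(\le\) 2, \(\frac{a^r}{3^r}\cdot\frac{3^{r+3}-3}{4(r+1)(r+2)(r+3)} > 1\). (Second half of Lemma 3(3) of the paper.) -/
theorem cubic_lt_const_mul_pow (r : ℕ) (hr : 8 ≤ r) :
    4 * ((r : ℝ) + 1) * (r + 2) * (r + 3) < 26 * 1.9 ^ r := by
  induction r, hr using Nat.le_induction with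
  | base => norm_num
  | succ n hn ih =>
    have hn' : (8 : ℝ) ≤ n := by exact_mod_cast hn
    have hstep : (n : ℝ) + 4 ≤ 1.9 * (n + 1) := by linarith
    have hpos : (0 : ℝ) ≤ 4 * ((n : ℝ) + 2) * (n + 3) := by positivity
    have := mul_le_mul_of_nonneg_left hstep hpos
    push_cast
    rw [pow_succ]
    nlinarith

/-- Second half of Lemma 3(3): for every even `r ≥ 8` and every `a ∈ [1.9, 2]`,
`f_r(a) = (a/3)^r (3^(r+3)-3)/(4(r+1)(r+2)(r+3)) > 1`. -/
theorem gwo_fr_gt_one (r : ℕ) (hreven : Even r) (hr8 : 8 ≤ r)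
    (a : ℝ) (ha1 : 1.9 ≤ a) (ha2 : a ≤ 2) :
    a ^ r / 3 ^ r *
        (((3 : ℝ) ^ (r + 3) - 3) / (4 * (r + 1) * (r + 2) * (r + 3))) > 1 := by
  have hcubic := cubic_lt_const_mul_pow r hr8
  have hpow : (1.9 : ℝ) ^ r ≤ a ^ r := pow_le_pow_left₀ (by norm_num) ha1 r
  have ha : (0 : ℝ) < a ^ r := pow_pos (by linarith) r
  have h3 : (3 : ℝ) ≤ 3 ^ r := le_self_pow₀ (by norm_num) (by omega)
  have hsub : 26 * (3 : ℝ) ^ r ≤ 3 ^ (r + 3) - 3 := by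
    rw [pow_add]
    linarith
  rw [gt_iff_lt, div_mul_div_comm, one_lt_div (by positivity)]
  calc (3 : ℝ) ^ r * (4 * (r + 1) * (r + 2) * (r + 3))
      < 3 ^ r * (26 * a ^ r) :=
        mul_lt_mul_of_pos_left (by linarith) (by positivity)
    _ = a ^ r * (26 * 3 ^ r) := by ring
    _ ≤ a ^ r * (3 ^ (r + 3) - 3) := by gcongr
end
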